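/- Let A be a nonempty finite set, let Q_X and Q_Y be strictly positive stochastic matrices on A with stationary probability vectors mu and mu~, and let P, P~ be the stationary Markov measures determined by (Q_X, mu) and (Q_Y, mu~). Let Q be any probability measure on A^N that is invariant and ergodic for the left shift. Then for (Q tensor P tensor P~)-almost every (g, omega, omega'): lim_{n->infinity} (1/n) ( log T_n(g | omega') - log T_n(g | omega) ) = sum_{x,y in A} Q{ g : g_1 = x, g_2 = y } * log( Q_X(x,y) / Q_Y(x,y) ), where omega is distributed according to P (the Q_X-chain) and omega' according to P~ (the Q_Y-chain). -/

import Mathlib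

open MeasureTheory Filter Finset Real

/-- Hitting time of the first `n` symbols of a fixed target sequence `g`:
`T_n(g|ω) = inf { k ≥ 0 : ω_{k+i} = g_i for all 1 ≤ i ≤ n }`. -/
noncomputable def hitTime {A : Type*} (n : ℕ) (g ω : ℕ → A) : ℕ :=
  sInf {k | ∀ i, 1 ≤ i → i ≤ n → ω (k + i) = g i}

/-- Running maxima of Birkhoff sums. -/
noncomputable def maxB {Ω : Type*} (T : Ω → Ω) (f : Ω → ℝ) : ℕ → Ω → ℝ
  | 0 => fun _ => 0
  | n + 1 => fun x => max 0 (f x + maxB T f n (T x))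

lemma maxB_nonneg {Ω : Type*} (T : Ω → Ω) (f : Ω → ℝ) (n : ℕ) (x : Ω) : 0 ≤ maxB T f n x := by
  cases n with
  | zero => simp [maxB]
  | succ n => simp [maxB]

lemma maxB_mono {Ω : Type*} (T : Ω → Ω) (f : Ω → ℝ) (n : ℕ) (x : Ω) :
    maxB T f n x ≤ maxB T f (n+1) x := by
  induction n generalizing x with
  | zero => exact maxB_nonneg T f 1 x
  | succ n ih =>
    have := ih (T x)
    simp only [maxB] at this ⊢
    gcongr

lemma birk_le_maxB {Ω : Type*} (T : Ω → Ω) (f : Ω → ℝ) (n : ℕ) (x : Ω) :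
    birkhoffSum T f n x ≤ maxB T f n x := by
  induction n generalizing x with
  | zero => simp [maxB]
  | succ n ih =>
    rw [birkhoffSum_succ']
    have := ih (T x)
    simp only [maxB]
    exact le_trans (by linarith) (le_max_right _ _)

lemma maxB_measurable {Ω : Type*} [MeasurableSpace Ω] {T : Ω → Ω} {f : Ω → ℝ} (hT : Measurable T)
    (hf : Measurable f) (n : ℕ) : Measurable (maxB T f n) := by
  induction n with
  | zero => exact measurable_const
  | succ n ih => exact measurable_const.max (hf.add (ih.comp hT))

lemma maxB_integrable {Ω : Type*} [MeasurableSpace Ω] {m : Measure Ω} {T : Ω → Ω} {f : Ω → ℝ}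
    (hT : MeasurePreserving T m m) (hf : Integrable f m) (n : ℕ) : Integrable (maxB T f n) m := by
  induction n with
  | zero => exact integrable_zero _ _ _
  | succ n ih =>
    exact (integrable_zero _ _ _).sup (hf.add (hT.integrable_comp_of_integrable ih))

lemma birk_bdd {Ω : Type*} [MeasurableSpace Ω] {m : Measure Ω} [IsProbabilityMeasure m]
    {T : Ω → Ω} {f : Ω → ℝ} (hT : Ergodic T m) (hf : Measurable f) (hfi : Integrable f m)
    (hneg : ∫ x, f x ∂m < 0) : ∀ᵐ x ∂m, ∃ C : ℕ, ∀ n, birkhoffSum T f n x ≤ C := by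
  set D : Set Ω := {x | ∀ C : ℕ, ∃ n, (C : ℝ) < maxB T f n x} with hD
  have hDm : MeasurableSet D := by
    have : D = ⋂ C : ℕ, ⋃ n, {x | (C : ℝ) < maxB T f n x} := by ext; simp [hD]
    rw [this]
    exact MeasurableSet.iInter fun C => MeasurableSet.iUnion fun n =>
      measurableSet_lt measurable_const (maxB_measurable hT.measurable hf n)
  have hinv : T ⁻¹' D = D := by
    ext x
    simp only [Set.mem_preimage, hD, Set.mem_ofPred_eq]
    constructor
    · intro h C
      obtain ⟨C', hC'⟩ := exists_nat_ge (C - f x)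
      obtain ⟨n, hn⟩ := h C'
      refine ⟨n+1, ?_⟩
      simp only [maxB]
      exact lt_of_lt_of_le (by linarith) (le_max_right _ _)
    · intro h C
      obtain ⟨C', hC'⟩ := exists_nat_ge (C + f x)
      obtain ⟨n, hn⟩ := h C'
      cases n with
      | zero =>
        exfalso
        simp only [maxB] at hn
        have : (0:ℝ) ≤ C' := Nat.cast_nonneg _
        linarith
      | succ n =>
        refine ⟨n, ?_⟩
        simp only [maxB] at hn
        rcases lt_max_iff.1 hn with h1 | h1
        · have : (0:ℝ) ≤ C' := Nat.cast_nonneg _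
          linarith
        · linarith
  have hmono : ∀ x, Monotone fun n => maxB T f n x := fun x => monotone_nat_of_le_succ fun n =>
    maxB_mono T f n x
  rcases hT.toPreErgodic.prob_eq_zero_or_one hDm hinv with h0 | h1
  · have : ∀ᵐ x ∂m, x ∉ D := measure_eq_zero_iff_ae_notMem.1 h0
    filter_upwards [this] with x hx
    simp only [hD, Set.mem_ofPred_eq, not_forall, not_exists, not_lt] at hx
    obtain ⟨C, hC⟩ := hx
    exact ⟨C, fun n => (birk_le_maxB T f n x).trans (hC n)⟩
  · exfalso
    have hae : ∀ᵐ x ∂m, x ∈ D := by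
      rw [← prob_compl_eq_zero_iff hDm] at h1
      exact (measure_eq_zero_iff_ae_notMem.1 h1).mono fun x hx => by simpa using hx
    have hmp := hT.toMeasurePreserving
    have hI := fun n => maxB_integrable hmp hfi n
    have key : Tendsto (fun n => ∫ x, (maxB T f (n+1) x - maxB T f n (T x)) ∂m) atTop
        (nhds (∫ x, f x ∂m)) := by
      refine tendsto_integral_of_dominated_convergence (fun x => |f x|) ?_ hfi.abs ?_ ?_
      · intro n
        exact ((hI (n+1)).sub (hmp.integrable_comp_of_integrable (hI n))).aestronglyMeasurable
      · intro n
        refine Eventually.of_forall fun x => ?_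
        have h1 := maxB_nonneg T f n (T x)
        simp only [maxB, Real.norm_eq_abs]
        rcases max_cases 0 (f x + maxB T f n (T x)) with h | h <;> rw [h.1]
        · rw [zero_sub, abs_neg, abs_of_nonneg h1]
          have := neg_le_abs (f x); linarith
        · rw [add_sub_cancel_right]
      · filter_upwards [hae] with x hx
        have hx' : T x ∈ D := by rw [← hinv] at hx; exact hx
        obtain ⟨C', hC'⟩ := exists_nat_ge (- f x)
        obtain ⟨N, hN⟩ := hx' C'
        refine tendsto_const_nhds.congr' ?_
        filter_upwards [eventually_ge_atTop N] with n hn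
        have := hmono (T x) hn
        simp only [maxB] at this ⊢
        rw [max_eq_right (by linarith)]; ring
    have hge : ∀ n, 0 ≤ ∫ x, (maxB T f (n+1) x - maxB T f n (T x)) ∂m := by
      intro n
      have hc : Integrable (fun x => maxB T f n (T x)) m :=
        hmp.integrable_comp_of_integrable (hI n)
      rw [integral_sub (hI _) hc]
      have : ∫ x, maxB T f n (T x) ∂m = ∫ x, maxB T f n x ∂m := by
        conv_rhs => rw [← hmp.map_eq]
        rw [integral_map hmp.measurable.aemeasurable]
        exact (maxB_measurable hT.measurable hf n).aestronglyMeasurable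
      rw [this, sub_nonneg]
      exact integral_mono (hI _) (hI _) fun x => maxB_mono T f n x
    linarith [ge_of_tendsto' key hge]

lemma birk_upper {Ω : Type*} [MeasurableSpace Ω] {m : Measure Ω} [IsProbabilityMeasure m]
    {T : Ω → Ω} {f : Ω → ℝ} (hT : Ergodic T m) (hf : Measurable f) (hfi : Integrable f m)
    {ε : ℝ} (hε : 0 < ε) :
    ∀ᵐ x ∂m, ∀ᶠ n : ℕ in atTop, birkhoffSum T f n x / n ≤ ∫ x, f x ∂m + 2 * ε := by
  have h := birk_bdd (f := fun x => f x - (∫ x, f x ∂m + ε)) hT (hf.sub_const _)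
    (hfi.sub (integrable_const _)) (by
      rw [integral_sub hfi (integrable_const _)]
      simp [hε])
  filter_upwards [h] with x ⟨C, hC⟩
  obtain ⟨N, hN⟩ := exists_nat_ge (C / ε)
  filter_upwards [eventually_ge_atTop (N+1)] with n hn
  have h1 := hC n
  have hn' : (N:ℝ) + 1 ≤ n := by exact_mod_cast hn
  have hNpos : (0:ℝ) ≤ N := Nat.cast_nonneg _
  have e : birkhoffSum T (fun x => f x - (∫ x, f x ∂m + ε)) n x
      = birkhoffSum T f n x - n * (∫ x, f x ∂m + ε) := by
    simp [birkhoffSum, Finset.sum_sub_distrib, mul_add]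
  rw [e] at h1
  rw [div_le_iff₀ hε] at hN
  rw [div_le_iff₀ (by linarith)]
  nlinarith

/-- Birkhoff's pointwise ergodic theorem, ergodic case. -/
lemma birk {Ω : Type*} [MeasurableSpace Ω] {m : Measure Ω} [IsProbabilityMeasure m]
    {T : Ω → Ω} {f : Ω → ℝ} (hT : Ergodic T m) (hf : Measurable f) (hfi : Integrable f m) :
    ∀ᵐ x ∂m, Tendsto (fun n : ℕ => birkhoffSum T f n x / n) atTop (nhds (∫ x, f x ∂m)) := by
  have h1 : ∀ᵐ x ∂m, ∀ q : ℕ, ∀ᶠ n : ℕ in atTop,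
      birkhoffSum T f n x / n ≤ ∫ x, f x ∂m + 2 * (1 / ((q:ℝ) + 1)) :=
    ae_all_iff.2 fun q => birk_upper hT hf hfi (by positivity)
  have h2 : ∀ᵐ x ∂m, ∀ q : ℕ, ∀ᶠ n : ℕ in atTop,
      birkhoffSum T (fun x => - f x) n x / n ≤ ∫ x, - f x ∂m + 2 * (1 / ((q:ℝ) + 1)) :=
    ae_all_iff.2 fun q => birk_upper hT hf.neg hfi.neg (by positivity)
  filter_upwards [h1, h2] with x h1 h2
  rw [Metric.tendsto_atTop']
  intro ε hε
  obtain ⟨q, hq⟩ := exists_nat_one_div_lt (show 0 < ε / 2 by linarith)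
  obtain ⟨N, hN⟩ := eventually_atTop.1 ((h1 q).and (h2 q))
  refine ⟨N, fun n hn => ?_⟩
  obtain ⟨a, b⟩ := hN n hn.le
  have e : birkhoffSum T (fun x => - f x) n x / n = - (birkhoffSum T f n x / n) := by
    simp [birkhoffSum, neg_div]
  rw [e, integral_neg] at b
  rw [Real.dist_eq, abs_lt]
  constructor <;> linarith

/-- The set of trajectories which match the first `n` symbols of `g` at time `k`. -/
def hitSet {A : Type*} (n : ℕ) (g : ℕ → A) (k : ℕ) : Set (ℕ → A) :=
  {ω | ∀ i, 1 ≤ i → i ≤ n → ω (k + i) = g i}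

lemma hitSet_meas {A : Type*} [MeasurableSpace A] [MeasurableSingletonClass A]
    (n : ℕ) (g : ℕ → A) (k : ℕ) : MeasurableSet (hitSet n g k) := by
  have : hitSet n g k = ⋂ i, ⋂ (_ : 1 ≤ i), ⋂ (_ : i ≤ n), (fun ω : ℕ → A => ω (k+i)) ⁻¹' {g i} := by
    ext; simp [hitSet]
  rw [this]
  exact MeasurableSet.iInter fun i => MeasurableSet.iInter fun _ => MeasurableSet.iInter fun _ =>
    (measurable_pi_apply _) (measurableSet_singleton _)

lemma cyl_meas {A : Type*} [MeasurableSpace A] [MeasurableSingletonClass A]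
    (n : ℕ) (a : ℕ → A) : MeasurableSet {ω : ℕ → A | ∀ i ≤ n, ω i = a i} := by
  have : {ω : ℕ → A | ∀ i ≤ n, ω i = a i}
      = ⋂ i, ⋂ (_ : i ≤ n), (fun ω : ℕ → A => ω i) ⁻¹' {a i} := by
    ext; simp
  rw [this]
  exact MeasurableSet.iInter fun i => MeasurableSet.iInter fun _ =>
    (measurable_pi_apply _) (measurableSet_singleton _)

/-- The weight of the first transitions along `g`. -/
noncomputable def wt {A : Type*} (Q : A → A → ℝ) (g : ℕ → A) (n : ℕ) : ℝ :=
  ∏ i ∈ Finset.range n, Q (g (i+1)) (g (i+2))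

lemma wt_pos {A : Type*} {Q : A → A → ℝ} (hQ : ∀ x y, 0 < Q x y) (g : ℕ → A) (n : ℕ) :
    0 < wt Q g n := Finset.prod_pos fun _ _ => hQ _ _

lemma wt_le_one {A : Type*} {Q : A → A → ℝ} (hQ : ∀ x y, 0 < Q x y) (hQ1 : ∀ x y, Q x y ≤ 1)
    (g : ℕ → A) (n : ℕ) : wt Q g n ≤ 1 :=
  Finset.prod_le_one (fun _ _ => (hQ _ _).le) fun _ _ => hQ1 _ _

lemma cyl_hit {A : Type*} [MeasurableSpace A]
    {Q : A → A → ℝ} {μ : A → ℝ} {c : ℝ}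
    (hc : 0 < c) (hc1 : c ≤ 1) (hQc : ∀ x y, c ≤ Q x y) (hQ1 : ∀ x y, Q x y ≤ 1)
    (P : Measure (ℕ → A))
    (hP : ∀ (n : ℕ) (a : ℕ → A),
      P.real {ω | ∀ i ≤ n, ω i = a i}
        = μ (a 0) * ∏ i ∈ Finset.range n, Q (a i) (a (i + 1)))
    (n k : ℕ) (g a : ℕ → A) :
    c * wt Q g n * P.real {ω | ∀ i ≤ k, ω i = a i}
        ≤ P.real ({ω | ∀ i ≤ k, ω i = a i} ∩ hitSet n g k) ∧
    c * P.real ({ω | ∀ i ≤ k, ω i = a i} ∩ hitSet n g k)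
        ≤ wt Q g n * P.real {ω | ∀ i ≤ k, ω i = a i} := by
  set b : ℕ → A := fun i => if i ≤ k then a i else g (i - k) with hb
  have hset : {ω | ∀ i ≤ k, ω i = a i} ∩ hitSet n g k = {ω | ∀ i ≤ k + n, ω i = b i} := by
    ext ω
    simp only [Set.mem_inter_iff, hitSet, Set.mem_ofPred_eq, hb]
    constructor
    · rintro ⟨h1, h2⟩ i hi
      split_ifs with h
      · exact h1 i h
      · have := h2 (i - k) (by omega) (by omega)
        rwa [show k + (i - k) = i by omega] at this
    · intro h
      refine ⟨fun i hi => ?_, fun i h1 h2 => ?_⟩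
      · have := h i (by omega)
        rwa [if_pos hi] at this
      · have := h (k + i) (by omega)
        rwa [if_neg (by omega), show k + i - k = i by omega] at this
  have hQpos : ∀ x y, 0 < Q x y := fun x y => hc.trans_le (hQc x y)
  rw [hset, hP (k + n) b, Finset.prod_range_add, ← mul_assoc]
  have e1 : ∏ i ∈ Finset.range k, Q (b i) (b (i + 1))
      = ∏ i ∈ Finset.range k, Q (a i) (a (i + 1)) := by
    refine Finset.prod_congr rfl fun i hi => ?_
    have := Finset.mem_range.1 hi
    simp only [hb]
    rw [if_pos (by omega), if_pos (by omega)]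
  have e0 : b 0 = a 0 := by simp [hb]
  rw [e1, e0, ← hP]
  have hp : 0 ≤ P.real {ω | ∀ i ≤ k, ω i = a i} := measureReal_nonneg
  generalize P.real {ω | ∀ i ≤ k, ω i = a i} = p at hp
  have hv : c * wt Q g n ≤ ∏ i ∈ Finset.range n, Q (b (k + i)) (b (k + i + 1)) ∧
      c * ∏ i ∈ Finset.range n, Q (b (k + i)) (b (k + i + 1)) ≤ wt Q g n := by
    cases n with
    | zero => simp [wt, hc1]
    | succ n =>
      have e2 : ∏ i ∈ Finset.range (n+1), Q (b (k + i)) (b (k + i + 1))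
          = wt Q g n * Q (b k) (b (k+1)) := by
        rw [Finset.prod_range_succ', wt]
        congr 1
        refine Finset.prod_congr rfl fun i hi => ?_
        simp only [hb]
        rw [if_neg (by omega), if_neg (by omega)]
        congr 2 <;> omega
      have e3 : wt Q g (n+1) = wt Q g n * Q (g (n+1)) (g (n+2)) := by
        rw [wt, Finset.prod_range_succ, wt]
      rw [e2, e3]
      have hw := wt_pos hQpos g n
      have h1 := hQc (b k) (b (k+1))
      have h2 := hQ1 (b k) (b (k+1))
      have h3 := hQc (g (n+1)) (g (n+2))
      have h4 := hQ1 (g (n+1)) (g (n+2))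
      have key : ∀ s t : ℝ, c ≤ t → s ≤ 1 → c * s ≤ t := fun s t ht hs => by nlinarith
      constructor
      · nlinarith [mul_le_mul_of_nonneg_left (key _ _ h1 h4) hw.le]
      · nlinarith [mul_le_mul_of_nonneg_left (key _ _ h3 h2) hw.le]
  constructor
  · nlinarith [mul_le_mul_of_nonneg_left hv.1 hp]
  · nlinarith [mul_le_mul_of_nonneg_left hv.2 hp]

lemma real_split {A : Type*} [Fintype A] [Nonempty A] [MeasurableSpace A]
    [MeasurableSingletonClass A] (P : Measure (ℕ → A)) [IsProbabilityMeasure P] (k : ℕ)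
    (x0 : A) (S : Set (ℕ → A)) (hS : MeasurableSet S) :
    P.real S = ∑ a : Fin (k+1) → A,
      P.real ({ω | ∀ i ≤ k, ω i = if h : i < k + 1 then a ⟨i, h⟩ else x0} ∩ S) := by
  rw [← measureReal_iUnion_fintype]
  · congr 1
    ext ω
    simp only [Set.mem_iUnion, Set.mem_inter_iff, Set.mem_ofPred_eq]
    constructor
    · intro h
      refine ⟨fun i => ω i, fun i hi => ?_, h⟩
      rw [dif_pos (by omega)]
    · rintro ⟨_, _, h⟩
      exact h
  · intro a a' haa'
    refine Set.disjoint_left.2 ?_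
    rintro ω ⟨h1, _⟩ ⟨h2, _⟩
    apply haa'
    ext i
    have q1 := h1 i (by omega)
    have q2 := h2 i (by omega)
    rw [dif_pos i.2] at q1 q2
    exact q1.symm.trans q2
  · intro a
    exact (cyl_meas k _).inter hS

lemma dep_hit {A : Type*} [Fintype A] [Nonempty A] [MeasurableSpace A] [MeasurableSingletonClass A]
    {Q : A → A → ℝ} {μ : A → ℝ} {c : ℝ}
    (hc : 0 < c) (hc1 : c ≤ 1) (hQc : ∀ x y, c ≤ Q x y) (hQ1 : ∀ x y, Q x y ≤ 1)
    (P : Measure (ℕ → A)) [IsProbabilityMeasure P]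
    (hP : ∀ (n : ℕ) (a : ℕ → A),
      P.real {ω | ∀ i ≤ n, ω i = a i}
        = μ (a 0) * ∏ i ∈ Finset.range n, Q (a i) (a (i + 1)))
    (n k : ℕ) (g : ℕ → A) (B : Set (ℕ → A)) (hB : MeasurableSet B)
    (hdep : ∀ ω ω' : ℕ → A, (∀ i ≤ k, ω i = ω' i) → ω ∈ B → ω' ∈ B) :
    c * wt Q g n * P.real B ≤ P.real (B ∩ hitSet n g k) ∧
    c * P.real (B ∩ hitSet n g k) ≤ wt Q g n * P.real B := by
  obtain ⟨x0⟩ := ‹Nonempty A›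
  rw [real_split P k x0 B hB, real_split P k x0 _ (hB.inter (hitSet_meas n g k))]
  rw [Finset.mul_sum, Finset.mul_sum, Finset.mul_sum]
  have main : ∀ a : ℕ → A,
      c * wt Q g n * P.real ({ω | ∀ i ≤ k, ω i = a i} ∩ B)
        ≤ P.real ({ω | ∀ i ≤ k, ω i = a i} ∩ (B ∩ hitSet n g k)) ∧
      c * P.real ({ω | ∀ i ≤ k, ω i = a i} ∩ (B ∩ hitSet n g k))
        ≤ wt Q g n * P.real ({ω | ∀ i ≤ k, ω i = a i} ∩ B) := by
    intro a
    rw [← Set.inter_assoc]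
    by_cases ha : a ∈ B
    · have : {ω : ℕ → A | ∀ i ≤ k, ω i = a i} ∩ B = {ω | ∀ i ≤ k, ω i = a i} := by
        refine Set.inter_eq_left.2 fun ω hω => hdep a ω (fun i hi => (hω i hi).symm) ha
      rw [this]
      exact cyl_hit hc hc1 hQc hQ1 P hP n k g a
    · have : {ω : ℕ → A | ∀ i ≤ k, ω i = a i} ∩ B = ∅ := by
        refine Set.eq_empty_of_forall_notMem ?_
        rintro ω ⟨h1, h2⟩
        exact ha (hdep ω a h1 h2)
      rw [this]
      simp
  exact ⟨Finset.sum_le_sum fun a _ => (main _).1, Finset.sum_le_sum fun a _ => (main _).2⟩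

lemma miss_bound {A : Type*} [Fintype A] [Nonempty A] [MeasurableSpace A]
    [MeasurableSingletonClass A]
    {Q : A → A → ℝ} {μ : A → ℝ} {c : ℝ}
    (hc : 0 < c) (hc1 : c ≤ 1) (hQc : ∀ x y, c ≤ Q x y) (hQ1 : ∀ x y, Q x y ≤ 1)
    (P : Measure (ℕ → A)) [IsProbabilityMeasure P]
    (hP : ∀ (n : ℕ) (a : ℕ → A),
      P.real {ω | ∀ i ≤ n, ω i = a i}
        = μ (a 0) * ∏ i ∈ Finset.range n, Q (a i) (a (i + 1)))
    (n m : ℕ) (g : ℕ → A) :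
    P.real {ω | ∀ j < m, ω ∉ hitSet n g (j * n)} ≤ (1 - c * wt Q g n) ^ m := by
  have hQpos : ∀ x y, 0 < Q x y := fun x y => hc.trans_le (hQc x y)
  induction m with
  | zero => simp
  | succ m ih =>
    set E := {ω : ℕ → A | ∀ j < m, ω ∉ hitSet n g (j * n)} with hE
    have hEm : MeasurableSet E := by
      have : E = ⋂ j, ⋂ (_ : j < m), (hitSet n g (j * n))ᶜ := by ext; simp [hE]
      rw [this]
      exact MeasurableSet.iInter fun j => MeasurableSet.iInter fun _ => (hitSet_meas _ _ _).compl
    have hs : {ω : ℕ → A | ∀ j < m + 1, ω ∉ hitSet n g (j * n)} = E \ hitSet n g (m * n) := by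
      ext ω
      simp only [hE, Set.mem_sdiff, Set.mem_ofPred_eq]
      constructor
      · intro h
        exact ⟨fun j hj => h j (by omega), h m (by omega)⟩
      · rintro ⟨h1, h2⟩ j hj
        rcases Nat.lt_succ_iff_lt_or_eq.1 hj with h | rfl
        · exact h1 j h
        · exact h2
    have hd := (dep_hit hc hc1 hQc hQ1 P hP n (m * n) g E hEm (by
      intro ω ω' hω h j hj hj'
      refine h j hj fun i h1 h2 => ?_
      rw [hω _ ?_]
      · exact hj' i h1 h2
      · calc j * n + i ≤ j * n + n := by omega
          _ = (j+1) * n := by ring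
          _ ≤ m * n := Nat.mul_le_mul_right _ hj)).1
    have hsum := measureReal_sdiff_add_inter (μ := P) (s := E) (hitSet_meas n g (m * n))
    rw [hs, pow_succ]
    have hw := wt_le_one hQpos hQ1 g n
    have hw0 := wt_pos hQpos g n
    have : 0 ≤ 1 - c * wt Q g n := by nlinarith
    nlinarith [mul_le_mul_of_nonneg_right ih this]

lemma early_bound {A : Type*} [Fintype A] [Nonempty A] [MeasurableSpace A]
    [MeasurableSingletonClass A]
    {Q : A → A → ℝ} {μ : A → ℝ} {c : ℝ}
    (hc : 0 < c) (hc1 : c ≤ 1) (hQc : ∀ x y, c ≤ Q x y) (hQ1 : ∀ x y, Q x y ≤ 1)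
    (P : Measure (ℕ → A)) [IsProbabilityMeasure P]
    (hP : ∀ (n : ℕ) (a : ℕ → A),
      P.real {ω | ∀ i ≤ n, ω i = a i}
        = μ (a 0) * ∏ i ∈ Finset.range n, Q (a i) (a (i + 1)))
    (n K : ℕ) (g : ℕ → A) :
    P.real {ω | ∃ j < K, ω ∈ hitSet n g j} ≤ K * (wt Q g n / c) := by
  have hs : {ω : ℕ → A | ∃ j < K, ω ∈ hitSet n g j} = ⋃ j ∈ Finset.range K, hitSet n g j := by
    ext; simp
  rw [hs]
  refine (measureReal_biUnion_finset_le _ _).trans ?_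
  calc _ ≤ ∑ j ∈ Finset.range K, wt Q g n / c := by
        refine Finset.sum_le_sum fun j _ => ?_
        have := (dep_hit hc hc1 hQc hQ1 P hP n j g Set.univ MeasurableSet.univ
          (fun _ _ _ _ => trivial)).2
        rw [Set.univ_inter, probReal_univ, mul_one] at this
        rw [le_div_iff₀ hc]
        linarith
    _ = _ := by simp

lemma log_succ_bounds (t : ℕ) : Real.log t ≤ Real.log ((t:ℝ) + 1) ∧
    Real.log ((t:ℝ) + 1) ≤ Real.log t + Real.log 2 := by
  rcases Nat.eq_zero_or_pos t with rfl | h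
  · simp [Real.log_nonneg]
  · have h' : (1:ℝ) ≤ t := by exact_mod_cast h
    refine ⟨Real.log_le_log (by linarith) (by linarith), ?_⟩
    rw [← Real.log_mul (by linarith) (by norm_num)]
    exact Real.log_le_log (by linarith) (by linarith)

lemma hit_eps {A : Type*} [Fintype A] [Nonempty A] [MeasurableSpace A]
    [MeasurableSingletonClass A]
    {Q : A → A → ℝ} {μ : A → ℝ} {c : ℝ}
    (hc : 0 < c) (hc1 : c ≤ 1) (hQc : ∀ x y, c ≤ Q x y) (hQ1 : ∀ x y, Q x y ≤ 1)
    (P : Measure (ℕ → A)) [IsProbabilityMeasure P]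
    (hP : ∀ (n : ℕ) (a : ℕ → A),
      P.real {ω | ∀ i ≤ n, ω i = a i}
        = μ (a 0) * ∏ i ∈ Finset.range n, Q (a i) (a (i + 1)))
    (g : ℕ → A) {ε : ℝ} (hε : 0 < ε) :
    ∀ᵐ ω ∂P, ∀ᶠ n : ℕ in atTop,
      |Real.log (hitTime n g ω) + Real.log (wt Q g n)| ≤ n * ε + Real.log n + Real.log 3 := by
  have hQpos : ∀ x y, 0 < Q x y := fun x y => hc.trans_le (hQc x y)
  have hsumm : Summable (fun n : ℕ => Real.exp (n * (-ε)) / c) :=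
    (Real.summable_exp_nat_mul_iff.2 (by linarith)).div_const c
  have bc : ∀ s : ℕ → Set (ℕ → A), (∀ n, P.real (s n) ≤ Real.exp (n * (-ε)) / c) →
      ∀ᵐ ω ∂P, ∀ᶠ n in atTop, ω ∉ s n := by
    intro s hs
    refine ae_eventually_notMem (ne_top_of_le_ne_top hsumm.tsum_ofReal_ne_top ?_)
    refine ENNReal.tsum_le_tsum fun n => ?_
    rw [← ofReal_measureReal (μ := P) (s := s n)]
    exact ENNReal.ofReal_le_ofReal (hs n)
  have h1 := bc (fun n => {ω | ∃ j < ⌊Real.exp (n * (-ε)) / wt Q g n⌋₊, ω ∈ hitSet n g j}) (by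
    intro n
    have hw := wt_pos hQpos g n
    refine (early_bound hc hc1 hQc hQ1 P hP n _ g).trans ?_
    have := Nat.floor_le (show 0 ≤ Real.exp (n * (-ε)) / wt Q g n by positivity)
    calc _ ≤ (Real.exp (n * (-ε)) / wt Q g n) * (wt Q g n / c) := by gcongr
      _ = _ := by field_simp)
  have h2 := bc (fun n => {ω | ∀ j < ⌈Real.exp (n * ε) / wt Q g n⌉₊, ω ∉ hitSet n g (j * n)}) (by
    intro n
    have hw := wt_pos hQpos g n
    have hw1 := wt_le_one hQpos hQ1 g n
    refine (miss_bound hc hc1 hQc hQ1 P hP n _ g).trans ?_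
    have hle := Nat.le_ceil (Real.exp (n * ε) / wt Q g n)
    set M := ⌈Real.exp (n * ε) / wt Q g n⌉₊
    calc (1 - c * wt Q g n) ^ M ≤ (Real.exp (-(c * wt Q g n))) ^ M := by
          gcongr
          · nlinarith
          · have := Real.add_one_le_exp (-(c * wt Q g n)); linarith
      _ = Real.exp (-(c * wt Q g n * M)) := by rw [← Real.exp_nat_mul]; congr 1; ring
      _ ≤ Real.exp (-(c * Real.exp (n * ε))) := by
          rw [Real.exp_le_exp, neg_le_neg_iff, mul_assoc]
          rw [div_le_iff₀ hw] at hle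
          have : wt Q g n * M = M * wt Q g n := mul_comm _ _
          rw [this]; gcongr
      _ ≤ (c * Real.exp (n * ε))⁻¹ := by
          rw [Real.exp_neg]
          gcongr
          have := Real.add_one_le_exp (c * Real.exp (n * ε)); linarith
      _ = _ := by rw [mul_inv, mul_neg, Real.exp_neg]; ring)
  filter_upwards [h1, h2] with ω h1 h2
  filter_upwards [h1, h2, eventually_ge_atTop 1] with n h1 h2 hn
  have hw := wt_pos hQpos g n
  have hw1 := wt_le_one hQpos hQ1 g n
  simp only [not_exists, not_and, not_forall, not_not] at h1 h2
  obtain ⟨j, hj, hjω⟩ := h2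
  have hT1 : hitTime n g ω ≤ j * n := Nat.sInf_le hjω
  have hTm : ω ∈ hitSet n g (hitTime n g ω) := Nat.sInf_mem (s := {k | ∀ i, 1 ≤ i → i ≤ n → ω (k + i) = g i}) ⟨_, hjω⟩
  have hT2 : ⌊Real.exp (n * (-ε)) / wt Q g n⌋₊ ≤ hitTime n g ω := by
    by_contra hlt
    exact h1 _ (not_le.1 hlt) hTm
  have hn' : (1:ℝ) ≤ n := by exact_mod_cast hn
  have hlog := log_succ_bounds (hitTime n g ω)
  generalize hitTime n g ω = t at *
  have hT2' : Real.exp (n * (-ε)) / wt Q g n ≤ (t:ℝ) + 1 := by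
    have := Nat.lt_floor_add_one (Real.exp (n * (-ε)) / wt Q g n)
    have h3 : ((⌊Real.exp (n * (-ε)) / wt Q g n⌋₊ : ℕ) : ℝ) ≤ t := by exact_mod_cast hT2
    linarith
  have hX : 1 ≤ Real.exp (n * ε) / wt Q g n := by
    rw [le_div_iff₀ hw, one_mul]
    exact hw1.trans (Real.one_le_exp (by positivity))
  have hT1' : (t:ℝ) + 1 ≤ 3 * n * (Real.exp (n * ε) / wt Q g n) := by
    have h4 : (j:ℝ) ≤ Real.exp (n * ε) / wt Q g n := (Nat.lt_ceil.1 hj).le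
    have h5 : (t:ℝ) ≤ j * n := by exact_mod_cast hT1
    nlinarith [mul_le_mul_of_nonneg_right h4 (by linarith : (0:ℝ) ≤ n)]
  have l1 := Real.log_le_log (by positivity) hT2'
  have l2 := Real.log_le_log (by positivity) hT1'
  rw [Real.log_div (by positivity) hw.ne', Real.log_exp] at l1
  rw [Real.log_mul (by positivity) (by positivity), Real.log_mul (by positivity) (by positivity),
    Real.log_div (by positivity) hw.ne', Real.log_exp] at l2
  have l3 : Real.log 2 ≤ Real.log 3 := Real.log_le_log (by norm_num) (by norm_num)
  have l4 : 0 ≤ Real.log n := Real.log_nonneg hn'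
  rw [abs_le]
  constructor <;> linarith

lemma hit_tendsto {A : Type*} [Fintype A] [Nonempty A] [MeasurableSpace A]
    [MeasurableSingletonClass A]
    {Q : A → A → ℝ} {μ : A → ℝ} (hQpos : ∀ x y, 0 < Q x y) (hQrow : ∀ x, ∑ y, Q x y = 1)
    (P : Measure (ℕ → A)) [IsProbabilityMeasure P]
    (hP : ∀ (n : ℕ) (a : ℕ → A),
      (P {ω | ∀ i ≤ n, ω i = a i}).toReal
        = μ (a 0) * ∏ i ∈ Finset.range n, Q (a i) (a (i + 1)))
    (g : ℕ → A) (L : ℝ)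
    (hg : Tendsto (fun n : ℕ => (∑ i ∈ Finset.range n, Real.log (Q (g (i+1)) (g (i+2)))) / n)
      atTop (nhds L)) :
    ∀ᵐ ω ∂P, Tendsto (fun n : ℕ => Real.log (hitTime n g ω) / n) atTop (nhds (-L)) := by
  have hQ1 : ∀ x y, Q x y ≤ 1 := fun x y => by
    rw [← hQrow x]
    exact Finset.single_le_sum (fun z _ => (hQpos x z).le) (Finset.mem_univ y)
  obtain ⟨⟨u, v⟩, huv⟩ := Finite.exists_min (fun p : A × A => Q p.1 p.2)
  have h : ∀ᵐ ω ∂P, ∀ q : ℕ, ∀ᶠ n : ℕ in atTop,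
      |Real.log (hitTime n g ω) + Real.log (wt Q g n)|
        ≤ n * (1 / ((q:ℝ) + 1)) + Real.log n + Real.log 3 :=
    ae_all_iff.2 fun q => hit_eps (hQpos u v) (hQ1 u v) (fun x y => huv (x, y)) hQ1 P hP g
      (by positivity)
  filter_upwards [h] with ω hω
  have hlogw : ∀ n, Real.log (wt Q g n)
      = ∑ i ∈ Finset.range n, Real.log (Q (g (i+1)) (g (i+2))) := fun n => by
    rw [wt, Real.log_prod]
    exact fun i _ => (hQpos _ _).ne'
  have hlim : Tendsto (fun n : ℕ => Real.log n / n + Real.log 3 / n) atTop (nhds 0) := by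
    rw [← add_zero (0:ℝ)]
    refine Tendsto.add ?_ (tendsto_const_div_atTop_nhds_zero_nat _)
    exact (Real.isLittleO_log_id_atTop.tendsto_div_nhds_zero).comp tendsto_natCast_atTop_atTop
  have hz : Tendsto (fun n : ℕ => (Real.log (hitTime n g ω) + Real.log (wt Q g n)) / n)
      atTop (nhds 0) := by
    rw [Metric.tendsto_atTop']
    intro ε hε
    obtain ⟨q, hq⟩ := exists_nat_one_div_lt (show 0 < ε / 2 by linarith)
    obtain ⟨N, hN⟩ := eventually_atTop.1
      (((hω q).and (hlim.eventually (gt_mem_nhds (show 0 < ε / 2 by linarith)))).and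
        (eventually_ge_atTop 1))
    refine ⟨N, fun n hn => ?_⟩
    obtain ⟨⟨h1, h2⟩, h3⟩ := hN n hn.le
    have hn0 : (0:ℝ) < n := by exact_mod_cast h3
    rw [Real.dist_eq, sub_zero, abs_div, abs_of_pos hn0]
    calc _ ≤ (n * (1 / ((q:ℝ) + 1)) + Real.log n + Real.log 3) / n := by gcongr
      _ = 1 / ((q:ℝ) + 1) + (Real.log n / n + Real.log 3 / n) := by field_simp; ring
      _ < ε := by linarith
  have := hz.sub hg
  rw [zero_sub] at this
  refine this.congr fun n => ?_
  rw [← hlogw]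
  ring

lemma hitTime_meas {A : Type*} [Countable A] [MeasurableSpace A] [MeasurableSingletonClass A]
    (n : ℕ) : Measurable fun z : (ℕ → A) × (ℕ → A) => hitTime n z.1 z.2 := by
  classical
  set p : (ℕ → A) × (ℕ → A) → ℕ → Prop := fun z k => z.2 ∈ hitSet n z.1 k with hp
  have hm : ∀ k, MeasurableSet {z | p z k} := by
    intro k
    have : {z | p z k} = ⋂ i, ⋂ (_ : 1 ≤ i), ⋂ (_ : i ≤ n),
        {z : (ℕ → A) × (ℕ → A) | z.2 (k+i) = z.1 i} := by
      ext; simp [hp, hitSet]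
    rw [this]
    exact MeasurableSet.iInter fun i => MeasurableSet.iInter fun _ => MeasurableSet.iInter fun _ =>
      measurableSet_eq_fun (by fun_prop) (by fun_prop)
  have hex : ∀ z, ∃ N, p z N ∨ ∀ k, ¬ p z k := fun z => by
    by_cases h : ∃ N, p z N
    · exact h.imp fun N h => Or.inl h
    · exact ⟨0, Or.inr (not_exists.1 h)⟩
  have e : (fun z : (ℕ → A) × (ℕ → A) => hitTime n z.1 z.2) = fun z => Nat.find (hex z) := by
    funext z
    symm
    rw [Nat.find_eq_iff]
    by_cases h : ∃ N, p z N
    · refine ⟨Or.inl (Nat.sInf_mem (s := {k | p z k}) h), fun m hm => ?_⟩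
      rintro (h' | h')
      · exact Nat.notMem_of_lt_sInf (s := {k | p z k}) hm h'
      · exact h.elim h'
    · have h0 : hitTime n z.1 z.2 = 0 := by
        have : {k | p z k} = ∅ := Set.eq_empty_of_forall_notMem (not_exists.1 h)
        change sInf {k | p z k} = 0
        rw [this, Nat.sInf_empty]
      rw [h0]
      exact ⟨Or.inr (not_exists.1 h), fun m hm => absurd hm (by omega)⟩
  rw [e]
  refine measurable_find hex fun k => ?_
  have : {z | p z k ∨ ∀ k, ¬ p z k} = {z | p z k} ∪ ⋂ k, {z | p z k}ᶜ := by ext; simp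
  rw [this]
  exact (hm k).union (MeasurableSet.iInter fun k => (hm k).compl)

lemma birk_Q {A : Type*} [Fintype A] [Nonempty A] [MeasurableSpace A] [MeasurableSingletonClass A]
    (F : A → A → ℝ)
    (Qm : Measure (ℕ → A)) [IsProbabilityMeasure Qm]
    (hQm : Ergodic (fun ω : ℕ → A => fun n : ℕ => ω (n + 1)) Qm) :
    ∀ᵐ g ∂Qm, Tendsto (fun n : ℕ => (∑ i ∈ Finset.range n, F (g (i+1)) (g (i+2))) / n)
      atTop (nhds (∑ x, ∑ y, (Qm {g | g 1 = x ∧ g 2 = y}).toReal * F x y)) := by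
  have hpm : Measurable fun g : ℕ → A => (g 1, g 2) := by fun_prop
  have hFm : Measurable fun p : A × A => F p.1 p.2 := measurable_of_finite _
  have hFi : Integrable (fun p : A × A => F p.1 p.2) (Qm.map fun g : ℕ → A => (g 1, g 2)) := by
    have : IsProbabilityMeasure (Qm.map fun g : ℕ → A => (g 1, g 2)) :=
      Measure.isProbabilityMeasure_map hpm.aemeasurable
    exact Integrable.of_finite
  have hi : ∫ g, F (g 1) (g 2) ∂Qm = ∑ x, ∑ y, (Qm {g | g 1 = x ∧ g 2 = y}).toReal * F x y := by
    have e := integral_map (μ := Qm) hpm.aemeasurable hFm.aestronglyMeasurable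
    have e2 := integral_fintype hFi
    simp only at e
    rw [← e, e2, Fintype.sum_prod_type]
    refine Finset.sum_congr rfl fun x _ => Finset.sum_congr rfl fun y _ => ?_
    rw [smul_eq_mul, measureReal_def, Measure.map_apply hpm (measurableSet_singleton _)]
    congr 3
    ext g
    simp
  have hb := birk (f := fun g : ℕ → A => F (g 1) (g 2)) hQm (hFm.comp hpm)
    (hFi.comp_measurable hpm)
  rw [hi] at hb
  filter_upwards [hb] with g hg
  refine hg.congr fun n => ?_
  congr 1
  refine Finset.sum_congr rfl fun i _ => ?_
  have : ∀ (i : ℕ) (g : ℕ → A) (k : ℕ),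
      ((fun ω : ℕ → A => fun n : ℕ => ω (n + 1))^[i] g) k = g (i + k) := by
    intro i
    induction i with
    | zero => intro g k; simp
    | succ i ih =>
      intro g k
      rw [Function.iterate_succ_apply, ih]
      congr 1; omega
  simp only [this]


/-- Shadowing a trajectory drawn from a stationary ergodic measure `Qm`: the difference of
the logarithms of the hitting times of the two chains has an a.s. limit given by the
`Qm`-pair frequencies weighted by `log(Q_X/Q_Y)`. -/
theorem stmt17
    {A : Type*} [Fintype A] [Nonempty A] [MeasurableSpace A] [MeasurableSingletonClass A]
    (QX QY : A → A → ℝ) (μ μt : A → ℝ)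
    (hQXpos : ∀ x y, 0 < QX x y) (hQXrow : ∀ x, ∑ y, QX x y = 1)
    (hQYpos : ∀ x y, 0 < QY x y) (hQYrow : ∀ x, ∑ y, QY x y = 1)
    (hμnonneg : ∀ x, 0 ≤ μ x) (hμsum : ∑ x, μ x = 1)
    (hμstat : ∀ y, ∑ x, μ x * QX x y = μ y)
    (hμtnonneg : ∀ x, 0 ≤ μt x) (hμtsum : ∑ x, μt x = 1)
    (hμtstat : ∀ y, ∑ x, μt x * QY x y = μt y)
    (P Pt : Measure (ℕ → A)) [IsProbabilityMeasure P] [IsProbabilityMeasure Pt]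
    (hP : ∀ (n : ℕ) (a : ℕ → A),
      (P {ω | ∀ i ≤ n, ω i = a i}).toReal
        = μ (a 0) * ∏ i ∈ Finset.range n, QX (a i) (a (i + 1)))
    (hPt : ∀ (n : ℕ) (a : ℕ → A),
      (Pt {ω | ∀ i ≤ n, ω i = a i}).toReal
        = μt (a 0) * ∏ i ∈ Finset.range n, QY (a i) (a (i + 1)))
    -- a stationary ergodic measure on path space (invariant and ergodic for the left shift)
    (Qm : Measure (ℕ → A)) [IsProbabilityMeasure Qm]
    (hQm : Ergodic (fun ω : ℕ → A => fun n : ℕ => ω (n + 1)) Qm) :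
    ∀ᵐ z ∂((Qm.prod P).prod Pt),
      Tendsto (fun n : ℕ =>
          (Real.log (hitTime n z.1.1 z.2) - Real.log (hitTime n z.1.1 z.1.2)) / n)
        atTop
        (nhds (∑ x, ∑ y,
          (Qm {g | g 1 = x ∧ g 2 = y}).toReal * Real.log (QX x y / QY x y))) := by

  have hm : ∀ n, Measurable fun z : ((ℕ → A) × (ℕ → A)) => Real.log (hitTime n z.1 z.2) := fun n =>
    Real.measurable_log.comp (measurable_from_nat.comp (hitTime_meas n))
  have hms : ∀ l : ℝ, MeasurableSet {z : (ℕ → A) × (ℕ → A) |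
      Tendsto (fun n : ℕ => Real.log (hitTime n z.1 z.2) / n) atTop (nhds l)} := fun l =>
    measurableSet_tendsto _ fun n => (hm n).div_const _
  have hX : ∀ᵐ z ∂(Qm.prod P), Tendsto (fun n : ℕ => Real.log (hitTime n z.1 z.2) / n) atTop
      (nhds (-∑ x, ∑ y, (Qm {g | g 1 = x ∧ g 2 = y}).toReal * Real.log (QX x y))) := by
    rw [Measure.ae_prod_iff_ae_ae (hms _)]
    filter_upwards [birk_Q (fun x y => Real.log (QX x y)) Qm hQm] with g hg
    exact hit_tendsto hQXpos hQXrow P hP g _ hg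
  have hY : ∀ᵐ z ∂(Qm.prod Pt), Tendsto (fun n : ℕ => Real.log (hitTime n z.1 z.2) / n) atTop
      (nhds (-∑ x, ∑ y, (Qm {g | g 1 = x ∧ g 2 = y}).toReal * Real.log (QY x y))) := by
    rw [Measure.ae_prod_iff_ae_ae (hms _)]
    filter_upwards [birk_Q (fun x y => Real.log (QY x y)) Qm hQm] with g hg
    exact hit_tendsto hQYpos hQYrow Pt hPt g _ hg
  have mp1 : MeasurePreserving Prod.fst ((Qm.prod P).prod Pt) (Qm.prod P) :=
    measurePreserving_fst
  have mp2 : MeasurePreserving (Prod.map Prod.fst id) ((Qm.prod P).prod Pt) (Qm.prod Pt) :=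
    measurePreserving_fst.prod (MeasurePreserving.id _)
  filter_upwards [mp1.quasiMeasurePreserving.ae hX, mp2.quasiMeasurePreserving.ae hY] with z h1 h2
  have h3 := h2.sub h1
  have e : -∑ x, ∑ y, (Qm {g | g 1 = x ∧ g 2 = y}).toReal * Real.log (QY x y)
      - -∑ x, ∑ y, (Qm {g | g 1 = x ∧ g 2 = y}).toReal * Real.log (QX x y)
      = ∑ x, ∑ y, (Qm {g | g 1 = x ∧ g 2 = y}).toReal * Real.log (QX x y / QY x y) := by
    rw [neg_sub_neg, ← Finset.sum_sub_distrib]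
    refine Finset.sum_congr rfl fun x _ => ?_
    rw [← Finset.sum_sub_distrib]
    refine Finset.sum_congr rfl fun y _ => ?_
    rw [Real.log_div (hQXpos x y).ne' (hQYpos x y).ne', mul_sub]
  rw [e] at h3
  refine h3.congr fun n => ?_
  simp only [Prod.map_fst, Prod.map_snd, id, sub_div]
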